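/- Under the hypotheses of the main theorem (b, b₁ ∈ C⁰([0,∞); C^{1+α}(ℝ^d)), w ∈ C^{1+α}([0,∞)×ℝ^d), μ₀ ∈ P(ℝ^d)), for each fixed t ≥ 0 the difference quotients (μ_t^{h_n} − μ_t^0)/h_n form a Cauchy sequence in (C^{1+α}(ℝ^d))* for every sequence h_n → 0, with limit independent of the sequence; hence h ↦ μ_t^h is differentiable at h = 0 in the Banach space Z = closure of M(ℝ^d) in (C^{1+α}(ℝ^d))*. -/

import Mathlib

open MeasureTheory Metric Filter
open scoped NNReal ENNReal BigOperators Topology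

noncomputable section

/-- Euclidean space ℝ^d. -/
abbrev Ed (d : ℕ) : Type := EuclideanSpace ℝ (Fin d)

/-- The α-Hölder seminorm of the gradient map `g = fderiv ℝ f`. -/
def holderSemi {d : ℕ} (α : ℝ) (g : Ed d → (Ed d →L[ℝ] ℝ)) : ℝ :=
  ⨆ x, ⨆ y, ‖g x - g y‖ / dist x y ^ α

/-- The C^{1+α} norm: sup|f| + sup|∇f| + α-Hölder seminorm of ∇f. -/
def c1aNorm {d : ℕ} (α : ℝ) (f : Ed d → ℝ) : ℝ :=
  (⨆ x, |f x|) + (⨆ x, ‖fderiv ℝ f x‖) + holderSemi α (fderiv ℝ f)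

/-- Membership in C^{1+α}(ℝ^d): bounded C¹ function with bounded, α-Hölder gradient. -/
def MemC1a {d : ℕ} (α : ℝ) (f : Ed d → ℝ) : Prop :=
  ContDiff ℝ 1 f ∧ BddAbove (Set.range fun x => |f x|) ∧
    BddAbove (Set.range fun x => ‖fderiv ℝ f x‖) ∧
    ∃ C : ℝ≥0, HolderWith C α.toNNReal (fderiv ℝ f)

/-- The dual norm on (C^{1+α}(ℝ^d))*, applied to a (not necessarily linear)
functional `L` on functions: sup of |L f| over ‖f‖_{C^{1+α}} ≤ 1. -/
def dualNorm {d : ℕ} (α : ℝ) (L : (Ed d → ℝ) → ℝ) : ℝ :=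
  sSup {r | ∃ f, MemC1a α f ∧ c1aNorm α f ≤ 1 ∧ r = |L f|}

/-- b ∈ C⁰([0,∞); C^{1+α}(ℝ^d)): continuous in time with values that are bounded C¹
vector fields, with bounded α-Hölder space derivative, uniformly in time. -/
def VecTimeC1a {d : ℕ} (α : ℝ) (b : ℝ → Ed d → Ed d) : Prop :=
  Continuous (Function.uncurry b) ∧ (∀ t, ContDiff ℝ 1 (b t)) ∧
    (∃ M : ℝ, ∀ t x, ‖b t x‖ + ‖fderiv ℝ (b t) x‖ ≤ M) ∧
    ∃ C : ℝ≥0, ∀ t, HolderWith C α.toNNReal (fderiv ℝ (b t))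

/-- w ∈ C^{1+α}([0,∞)×ℝ^d), encoded as: jointly continuous, C¹ and bounded in space
with bounded α-Hölder spatial gradient, uniformly in time. -/
def ScalTimeC1a {d : ℕ} (α : ℝ) (w : ℝ → Ed d → ℝ) : Prop :=
  Continuous (Function.uncurry w) ∧ (∀ t, ContDiff ℝ 1 (w t)) ∧
    (∃ M : ℝ, ∀ t x, |w t x| + ‖fderiv ℝ (w t) x‖ ≤ M) ∧
    ∃ C : ℝ≥0, ∀ t, HolderWith C α.toNNReal (fderiv ℝ (w t))

/-- The perturbed solution μ_t^h = X(t,·;h)#( e^{∫₀ᵗ w(s,X(s,·;h)) ds} μ₀ ). -/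
def muSol {d : ℕ} (X : ℝ → Ed d → ℝ → Ed d) (w : ℝ → Ed d → ℝ)
    (μ₀ : Measure (Ed d)) (t h : ℝ) : Measure (Ed d) :=
  Measure.map (fun y => X t y h)
    (μ₀.withDensity fun y =>
      ENNReal.ofReal (Real.exp (∫ s in (0:ℝ)..t, w s (X s y h))))

/-- Functionals on test functions; the ambient space containing (C^{1+α}(ℝ^d))*. -/
abbrev W (d : ℕ) : Type := (Ed d → ℝ) → ℝ

/-- Integration pairing of a finite signed (bounded Radon) measure against a function. -/
def sPair {d : ℕ} (s : SignedMeasure (Ed d)) (f : Ed d → ℝ) : ℝ :=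
  (∫ x, f x ∂s.toJordanDecomposition.posPart) - ∫ x, f x ∂s.toJordanDecomposition.negPart

/-- Membership in Z, the closure of M(ℝ^d) in (C^{1+α}(ℝ^d))*. -/
def InZM {d : ℕ} (α : ℝ) (z : W d) : Prop :=
  ∀ ε > (0 : ℝ), ∃ s : SignedMeasure (Ed d), dualNorm α (fun f => z f - sPair s f) ≤ ε

/-- A time-dependent map which, uniformly in time, is bounded by `M`, has derivative bounded by
`M`, and has `α`-Hölder derivative with constant `C`. -/
structure UniformC1a {E G : Type*} [NormedAddCommGroup E] [NormedSpace ℝ E]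
    [NormedAddCommGroup G] [NormedSpace ℝ G] (α M C : ℝ) (F : ℝ → E → G) : Prop where
  differentiable : ∀ t, Differentiable ℝ (F t)
  norm_le : ∀ t x, ‖F t x‖ ≤ M
  fderiv_le : ∀ t x, ‖fderiv ℝ (F t) x‖ ≤ M
  holder : ∀ t x y, ‖fderiv ℝ (F t) x - fderiv ℝ (F t) y‖ ≤ C * ‖x - y‖ ^ α

section Analysis

variable {E G : Type*} [NormedAddCommGroup E] [NormedSpace ℝ E]
  [NormedAddCommGroup G] [NormedSpace ℝ G]

namespace UniformC1a

variable {α M C : ℝ} {F : ℝ → E → G}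

lemma mono {M' C' : ℝ} (hF : UniformC1a α M C F) (hM : M ≤ M') (hC : C ≤ C') :
    UniformC1a α M' C' F where
  differentiable := hF.differentiable
  norm_le t x := (hF.norm_le t x).trans hM
  fderiv_le t x := (hF.fderiv_le t x).trans hM
  holder t x y := (hF.holder t x y).trans (by gcongr)

lemma lipschitz (hF : UniformC1a α M C F) (t : ℝ) (x y : E) :
    ‖F t x - F t y‖ ≤ M * ‖x - y‖ :=
  convex_univ.norm_image_sub_le_of_norm_fderiv_le (fun z _ => hF.differentiable t z)
    (fun z _ => hF.fderiv_le t z) (Set.mem_univ y) (Set.mem_univ x)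

lemma taylor (hF : UniformC1a α M C F) (hα : 0 ≤ α) (hC : 0 ≤ C) (t : ℝ) (x y : E) :
    ‖F t y - F t x - fderiv ℝ (F t) x (y - x)‖ ≤ C * ‖y - x‖ ^ α * ‖y - x‖ := by
  refine (convex_segment x y).norm_image_sub_le_of_norm_fderiv_le'
    (fun z _ => hF.differentiable t z) (fun z hz => ?_)
    (left_mem_segment ℝ x y) (right_mem_segment ℝ x y)
  refine (hF.holder t z x).trans ?_
  have : ‖z - x‖ ≤ ‖y - x‖ := by
    have := norm_sub_le_of_mem_segment hz
    simpa using this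
  exact mul_le_mul_of_nonneg_left (Real.rpow_le_rpow (norm_nonneg _) this hα) hC

end UniformC1a

lemma norm_quotient_sub_quotient_le {A : E →L[ℝ] G} {M : ℝ} (hA : ‖A‖ ≤ M)
    {p₀ p₁ p₂ : E} {q₀ q₁ q₂ : G} {h₁ h₂ r₁ r₂ : ℝ} (hh₁ : h₁ ≠ 0) (hh₂ : h₂ ≠ 0)
    (H₁ : ‖q₁ - q₀ - A (p₁ - p₀)‖ ≤ r₁ * |h₁|) (H₂ : ‖q₂ - q₀ - A (p₂ - p₀)‖ ≤ r₂ * |h₂|) :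
    ‖h₁⁻¹ • (q₁ - q₀) - h₂⁻¹ • (q₂ - q₀)‖ ≤
      r₁ + r₂ + M * ‖h₁⁻¹ • (p₁ - p₀) - h₂⁻¹ • (p₂ - p₀)‖ := by
  have key : h₁⁻¹ • (q₁ - q₀) - h₂⁻¹ • (q₂ - q₀) =
      h₁⁻¹ • (q₁ - q₀ - A (p₁ - p₀)) - h₂⁻¹ • (q₂ - q₀ - A (p₂ - p₀)) +
        A (h₁⁻¹ • (p₁ - p₀) - h₂⁻¹ • (p₂ - p₀)) := by
    rw [map_sub A (h₁⁻¹ • (p₁ - p₀)), map_smul, map_smul]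
    module
  have scaled {h r : ℝ} {z : G} (hh : h ≠ 0) (H : ‖z‖ ≤ r * |h|) : ‖h⁻¹ • z‖ ≤ r := by
    rw [norm_smul, norm_inv, Real.norm_eq_abs, inv_mul_le_iff₀ (abs_pos.mpr hh), mul_comm]
    exact H
  rw [key]
  refine (norm_add_le _ _).trans ?_
  gcongr
  · exact (norm_sub_le _ _).trans (add_le_add (scaled hh₁ H₁) (scaled hh₂ H₂))
  · exact A.le_of_opNorm_le hA _

lemma UniformC1a.quotient_sub_quotient_le {α M C K : ℝ} {F : ℝ → E → G}
    (hF : UniformC1a α M C F) (hα : 0 ≤ α) (hC : 0 ≤ C) (hK : 0 ≤ K)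
    {p₀ p₁ p₂ : E} {h₁ h₂ : ℝ} (hh₁ : h₁ ≠ 0) (hh₂ : h₂ ≠ 0)
    (H₁ : ‖p₁ - p₀‖ ≤ K * |h₁|) (H₂ : ‖p₂ - p₀‖ ≤ K * |h₂|) (t : ℝ) :
    ‖h₁⁻¹ • (F t p₁ - F t p₀) - h₂⁻¹ • (F t p₂ - F t p₀)‖ ≤
      C * K ^ α * K * (|h₁| ^ α + |h₂| ^ α) +
        M * ‖h₁⁻¹ • (p₁ - p₀) - h₂⁻¹ • (p₂ - p₀)‖ := by
  have rem {p : E} {h : ℝ} (H : ‖p - p₀‖ ≤ K * |h|) :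
      ‖F t p - F t p₀ - fderiv ℝ (F t) p₀ (p - p₀)‖ ≤ C * K ^ α * K * |h| ^ α * |h| :=
    calc _ ≤ C * ‖p - p₀‖ ^ α * ‖p - p₀‖ := hF.taylor hα hC t p₀ p
      _ ≤ C * (K * |h|) ^ α * (K * |h|) := by gcongr
      _ = _ := by rw [Real.mul_rpow hK (abs_nonneg h)]; ring
  refine (norm_quotient_sub_quotient_le (hF.fderiv_le t p₀) hh₁ hh₂ (rem H₁) (rem H₂)).trans_eq ?_
  ring

lemma norm_le_of_norm_deriv_le {A B T : ℝ} (hA : 0 ≤ A) {u u' : ℝ → E}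
    (hu : ∀ t, HasDerivAt u (u' t) t) (hu0 : u 0 = 0)
    (hB : ∀ t ∈ Set.Icc 0 T, ‖u' t‖ ≤ A * ‖u t‖ + B) (hB0 : 0 ≤ B) {t : ℝ}
    (ht : t ∈ Set.Icc 0 T) : ‖u t‖ ≤ gronwallBound 0 A 1 T * B := by
  have h := norm_le_gronwallBound_of_norm_deriv_right_le (f := u) (f' := u') (δ := 0) (K := A)
    (ε := B) (a := 0) (b := T) (fun s _ => (hu s).continuousAt.continuousWithinAt)
    (fun s _ => (hu s).hasDerivWithinAt) (by simp [hu0])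
    (fun s hs => hB s (Set.Ico_subset_Icc_self hs)) t ht
  refine h.trans ((gronwallBound_mono le_rfl hB0 hA (by simpa using ht.2)).trans_eq ?_)
  unfold gronwallBound
  split_ifs <;> ring

lemma gronwallBound_zero_one_nonneg {A T : ℝ} (hA : 0 ≤ A) (hT : 0 ≤ T) :
    0 ≤ gronwallBound 0 A 1 T := by
  have := gronwallBound_mono (le_refl (0 : ℝ)) zero_le_one hA hT
  rwa [gronwallBound_x0] at this

lemma abs_le_abs_rpow {α h : ℝ} (hα1 : α ≤ 1) (hh : |h| ≤ 1) : |h| ≤ |h| ^ α := by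
  rcases (abs_nonneg h).eq_or_lt with h0 | h0
  · rw [← h0]; positivity
  · simpa using Real.rpow_le_rpow_of_exponent_ge h0 hh hα1

section Trajectories

variable {α M C T h : ℝ} {b b₁ : ℝ → E → E} {x₀ x : ℝ → E}

lemma trajectory_sub_le (hb : UniformC1a α M C b) (hb₁ : UniformC1a α M C b₁)
    (hM : 0 ≤ M)
    (hx₀ : ∀ t, HasDerivAt x₀ (b t (x₀ t) + (0 : ℝ) • b₁ t (x₀ t)) t)
    (hx : ∀ t, HasDerivAt x (b t (x t) + h • b₁ t (x t)) t) (h0 : x 0 = x₀ 0)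
    {t : ℝ} (ht : t ∈ Set.Icc 0 T) :
    ‖x t - x₀ t‖ ≤ gronwallBound 0 M 1 T * M * |h| := by
  have := norm_le_of_norm_deriv_le (u := fun t => x t - x₀ t) (B := M * |h|) hM
    (fun t => (hx t).sub (hx₀ t)) (by simp [h0]) (fun t _ => ?_) (by positivity) ht
  · linarith
  · have e : b t (x t) + h • b₁ t (x t) - (b t (x₀ t) + (0 : ℝ) • b₁ t (x₀ t)) =
        (b t (x t) - b t (x₀ t)) + h • b₁ t (x t) := by module
    rw [e]
    refine (norm_add_le _ _).trans (add_le_add (hb.lipschitz _ _ _) ?_)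
    rw [norm_smul, Real.norm_eq_abs, mul_comm]
    gcongr
    exact hb₁.norm_le _ _

/-- The difference quotients in `h` of the perturbed trajectories satisfy a Cauchy estimate. -/
lemma exists_trajectory_quotient_le (hα : 0 < α) (hα1 : α ≤ 1) (hM : 0 ≤ M) (hC : 0 ≤ C)
    (hT : 0 ≤ T) (hb : UniformC1a α M C b) (hb₁ : UniformC1a α M C b₁) :
    ∃ L : ℝ, 0 ≤ L ∧ ∀ (x₀ x₁ x₂ : ℝ → E) (h₁ h₂ : ℝ), h₁ ≠ 0 → h₂ ≠ 0 → |h₁| ≤ 1 → |h₂| ≤ 1 →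
      (∀ t, HasDerivAt x₀ (b t (x₀ t) + (0 : ℝ) • b₁ t (x₀ t)) t) →
      (∀ t, HasDerivAt x₁ (b t (x₁ t) + h₁ • b₁ t (x₁ t)) t) →
      (∀ t, HasDerivAt x₂ (b t (x₂ t) + h₂ • b₁ t (x₂ t)) t) →
      x₁ 0 = x₀ 0 → x₂ 0 = x₀ 0 → ∀ t ∈ Set.Icc 0 T,
        ‖h₁⁻¹ • (x₁ t - x₀ t) - h₂⁻¹ • (x₂ t - x₀ t)‖ ≤ L * (|h₁| ^ α + |h₂| ^ α) := by
  have hg := gronwallBound_zero_one_nonneg hM hT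
  set g := gronwallBound 0 M 1 T with hgdef
  set K := g * M with hKdef
  have hK : 0 ≤ K := by positivity
  refine ⟨g * (C * K ^ α * K + M * K), by positivity, ?_⟩
  intro x₀ x₁ x₂ h₁ h₂ hh₁ hh₂ hl₁ hl₂ hx₀ hx₁ hx₂ e₁ e₂ t ht
  have hB {t} (ht : t ∈ Set.Icc 0 T) := trajectory_sub_le hb hb₁ hM hx₀ hx₁ e₁ ht
  have hB' {t} (ht : t ∈ Set.Icc 0 T) := trajectory_sub_le hb hb₁ hM hx₀ hx₂ e₂ ht
  have := norm_le_of_norm_deriv_le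
    (u := fun t => h₁⁻¹ • (x₁ t - x₀ t) - h₂⁻¹ • (x₂ t - x₀ t))
    (B := (C * K ^ α * K + M * K) * (|h₁| ^ α + |h₂| ^ α)) hM
    (fun t => (((hx₁ t).sub (hx₀ t)).const_smul h₁⁻¹).sub
      (((hx₂ t).sub (hx₀ t)).const_smul h₂⁻¹)) (by simp [e₁, e₂]) (fun t ht => ?_)
      (by positivity) ht
  · rw [← hgdef, ← mul_assoc] at this
    exact this
  · have e : h₁⁻¹ • (b t (x₁ t) + h₁ • b₁ t (x₁ t) - (b t (x₀ t) + (0 : ℝ) • b₁ t (x₀ t))) -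
        h₂⁻¹ • (b t (x₂ t) + h₂ • b₁ t (x₂ t) - (b t (x₀ t) + (0 : ℝ) • b₁ t (x₀ t))) =
        (h₁⁻¹ • (b t (x₁ t) - b t (x₀ t)) - h₂⁻¹ • (b t (x₂ t) - b t (x₀ t))) +
          ((b₁ t (x₁ t) - b₁ t (x₀ t)) - (b₁ t (x₂ t) - b₁ t (x₀ t))) := by
      match_scalars <;> field_simp <;> ring_nf
    rw [e]
    have q := hb.quotient_sub_quotient_le hα.le hC hK hh₁ hh₂ (hB ht) (hB' ht) t
    have q₁ := hb₁.lipschitz t (x₁ t) (x₀ t)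
    have q₂ := hb₁.lipschitz t (x₂ t) (x₀ t)
    have s₁ : M * ‖x₁ t - x₀ t‖ ≤ M * (K * |h₁| ^ α) := by
      gcongr
      exact (hB ht).trans (by gcongr; exact abs_le_abs_rpow hα1 hl₁)
    have s₂ : M * ‖x₂ t - x₀ t‖ ≤ M * (K * |h₂| ^ α) := by
      gcongr
      exact (hB' ht).trans (by gcongr; exact abs_le_abs_rpow hα1 hl₂)
    have n := norm_sub_le (b₁ t (x₁ t) - b₁ t (x₀ t)) (b₁ t (x₂ t) - b₁ t (x₀ t))
    refine (norm_add_le _ _).trans ?_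
    linarith

end Trajectories

lemma abs_exp_sub_one_sub_id_le_sq_mul_exp (x : ℝ) :
    |Real.exp x - 1 - x| ≤ |x| ^ 2 * Real.exp |x| := by
  have h := Complex.norm_exp_sub_sum_le_norm_mul_exp (x : ℂ) 2
  have e : Complex.exp x - ∑ m ∈ Finset.range 2, (x : ℂ) ^ m / (m.factorial : ℂ) =
      ((Real.exp x - 1 - x : ℝ) : ℂ) := by
    simp [Finset.sum_range_succ]
    ring
  rw [e] at h
  simpa only [Complex.norm_real, Real.norm_eq_abs] using h

lemma exp_quotient_sub_quotient_le {α K R L : ℝ} (hα1 : α ≤ 1)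
    (hK : 0 ≤ K) {v₀ v₁ v₂ h₁ h₂ : ℝ} (hh₁ : h₁ ≠ 0) (hh₂ : h₂ ≠ 0)
    (hl₁ : |h₁| ≤ 1) (hl₂ : |h₂| ≤ 1) (hv₀ : |v₀| ≤ R)
    (H₁ : |v₁ - v₀| ≤ K * |h₁|) (H₂ : |v₂ - v₀| ≤ K * |h₂|)
    (H : |h₁⁻¹ * (v₁ - v₀) - h₂⁻¹ * (v₂ - v₀)| ≤ L * (|h₁| ^ α + |h₂| ^ α)) :
    |h₁⁻¹ * (Real.exp v₁ - Real.exp v₀) - h₂⁻¹ * (Real.exp v₂ - Real.exp v₀)| ≤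
      Real.exp R * (K ^ 2 * Real.exp K + L) * (|h₁| ^ α + |h₂| ^ α) := by
  have hexp : Real.exp v₀ ≤ Real.exp R := Real.exp_le_exp.mpr ((le_abs_self _).trans hv₀)
  have rem {v h : ℝ} (hl : |h| ≤ 1) (Hv : |v - v₀| ≤ K * |h|) :
      ‖Real.exp v - Real.exp v₀ - (Real.exp v₀ • ContinuousLinearMap.id ℝ ℝ) (v - v₀)‖ ≤
        Real.exp R * (K ^ 2 * Real.exp K) * |h| ^ α * |h| := by
    have e : Real.exp v - Real.exp v₀ - (Real.exp v₀ • ContinuousLinearMap.id ℝ ℝ) (v - v₀) =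
        Real.exp v₀ * (Real.exp (v - v₀) - 1 - (v - v₀)) := by
      simp only [smul_apply, ContinuousLinearMap.id_apply, smul_eq_mul]
      rw [Real.exp_sub]
      field_simp
    rw [e, norm_mul, Real.norm_eq_abs, Real.norm_eq_abs, Real.abs_exp]
    have hK1 : |v - v₀| ≤ K := Hv.trans (mul_le_of_le_one_right hK hl)
    calc _ ≤ Real.exp R * (|v - v₀| ^ 2 * Real.exp |v - v₀|) := by
          gcongr
          exact abs_exp_sub_one_sub_id_le_sq_mul_exp _
      _ ≤ Real.exp R * ((K * |h|) ^ 2 * Real.exp K) := by gcongr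
      _ = Real.exp R * (K ^ 2 * Real.exp K) * |h| * |h| := by ring
      _ ≤ _ := by
        gcongr
        exact abs_le_abs_rpow hα1 hl
  have hA : ‖Real.exp v₀ • ContinuousLinearMap.id ℝ ℝ‖ ≤ Real.exp R := by
    rw [norm_smul, Real.norm_eq_abs, Real.abs_exp, ContinuousLinearMap.norm_id, mul_one]
    exact hexp
  have q := norm_quotient_sub_quotient_le hA hh₁ hh₂ (rem hl₁ H₁) (rem hl₂ H₂)
  simp only [smul_eq_mul, Real.norm_eq_abs] at q
  have := mul_le_mul_of_nonneg_left H (Real.exp_pos R).le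
  linarith

lemma mul_quotient_sub_quotient_le {α R S K K' L L' : ℝ} (hα1 : α ≤ 1)
    (hK : 0 ≤ K) (hK' : 0 ≤ K')
    {a₀ a₁ a₂ c₀ c₁ c₂ h₁ h₂ : ℝ} (hh₁ : h₁ ≠ 0) (hh₂ : h₂ ≠ 0)
    (hl₁ : |h₁| ≤ 1) (hl₂ : |h₂| ≤ 1) (ha₀ : |a₀| ≤ S) (hc₀ : |c₀| ≤ R)
    (A₁ : |a₁ - a₀| ≤ K * |h₁|) (A₂ : |a₂ - a₀| ≤ K * |h₂|)
    (C₁ : |c₁ - c₀| ≤ K' * |h₁|) (C₂ : |c₂ - c₀| ≤ K' * |h₂|)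
    (A : |h₁⁻¹ * (a₁ - a₀) - h₂⁻¹ * (a₂ - a₀)| ≤ L * (|h₁| ^ α + |h₂| ^ α))
    (C : |h₁⁻¹ * (c₁ - c₀) - h₂⁻¹ * (c₂ - c₀)| ≤ L' * (|h₁| ^ α + |h₂| ^ α)) :
    |h₁⁻¹ * (a₁ * c₁ - a₀ * c₀) - h₂⁻¹ * (a₂ * c₂ - a₀ * c₀)| ≤
      (L * R + S * L' + K * K') * (|h₁| ^ α + |h₂| ^ α) := by
  have rem {a c h : ℝ} (hh : h ≠ 0) (hl : |h| ≤ 1) (Ha : |a - a₀| ≤ K * |h|)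
      (Hc : |c - c₀| ≤ K' * |h|) : |h⁻¹ * (a - a₀) * (c - c₀)| ≤ K * K' * |h| ^ α := by
    rw [abs_mul, abs_mul, abs_inv]
    have : |h|⁻¹ * |a - a₀| ≤ K := by
      rw [inv_mul_le_iff₀ (abs_pos.mpr hh), mul_comm]; exact Ha
    calc _ ≤ K * (K' * |h|) := by gcongr
      _ = K * K' * |h| := by ring
      _ ≤ _ := by gcongr; exact abs_le_abs_rpow hα1 hl
  have e : h₁⁻¹ * (a₁ * c₁ - a₀ * c₀) - h₂⁻¹ * (a₂ * c₂ - a₀ * c₀) =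
      (h₁⁻¹ * (a₁ - a₀) - h₂⁻¹ * (a₂ - a₀)) * c₀ +
        a₀ * (h₁⁻¹ * (c₁ - c₀) - h₂⁻¹ * (c₂ - c₀)) +
        (h₁⁻¹ * (a₁ - a₀) * (c₁ - c₀) - h₂⁻¹ * (a₂ - a₀) * (c₂ - c₀)) := by ring
  rw [e]
  have t₁ : |(h₁⁻¹ * (a₁ - a₀) - h₂⁻¹ * (a₂ - a₀)) * c₀| ≤
      L * (|h₁| ^ α + |h₂| ^ α) * R := by
    rw [abs_mul]
    exact mul_le_mul A hc₀ (abs_nonneg _) ((abs_nonneg _).trans A)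
  have t₂ : |a₀ * (h₁⁻¹ * (c₁ - c₀) - h₂⁻¹ * (c₂ - c₀))| ≤
      S * (L' * (|h₁| ^ α + |h₂| ^ α)) := by
    rw [abs_mul]
    exact mul_le_mul ha₀ C (abs_nonneg _) ((abs_nonneg _).trans ha₀)
  have t₃ := (abs_sub _ _).trans (add_le_add (rem hh₁ hl₁ A₁ C₁) (rem hh₂ hl₂ A₂ C₂))
  refine (abs_add_three _ _ _).trans ?_
  linarith

lemma abs_exp_sub_exp_le {R u v : ℝ} (hu : |u| ≤ R) (hv : |v| ≤ R) :
    |Real.exp u - Real.exp v| ≤ Real.exp R * |u - v| :=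
  (convex_Iic R).norm_image_sub_le_of_norm_deriv_le (f := Real.exp)
    (fun z _ => Real.differentiableAt_exp)
    (fun z hz => by simpa using hz) ((le_abs_self v).trans hv)
    ((le_abs_self u).trans hu)

/-- The difference quotients in `h` of the endpoint value of a `C^{1+α}` observable, weighted by
the exponential of the integral of `w` along the trajectory, satisfy a Cauchy estimate. -/
lemma exists_weighted_quotient_le {α M C T : ℝ} (hα : 0 < α) (hα1 : α ≤ 1) (hM : 0 ≤ M)
    (hC : 0 ≤ C) (hT : 0 ≤ T) {b b₁ : ℝ → E → E} {w : ℝ → E → ℝ}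
    (hb : UniformC1a α M C b) (hb₁ : UniformC1a α M C b₁) (hw : UniformC1a α M C w)
    (hwc : Continuous (Function.uncurry w)) :
    ∃ L : ℝ, 0 ≤ L ∧ ∀ (x₀ x₁ x₂ : ℝ → E) (h₁ h₂ : ℝ), h₁ ≠ 0 → h₂ ≠ 0 → |h₁| ≤ 1 → |h₂| ≤ 1 →
      (∀ t, HasDerivAt x₀ (b t (x₀ t) + (0 : ℝ) • b₁ t (x₀ t)) t) →
      (∀ t, HasDerivAt x₁ (b t (x₁ t) + h₁ • b₁ t (x₁ t)) t) →
      (∀ t, HasDerivAt x₂ (b t (x₂ t) + h₂ • b₁ t (x₂ t)) t) →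
      x₁ 0 = x₀ 0 → x₂ 0 = x₀ 0 → ∀ f : E → ℝ, UniformC1a α 1 1 (fun _ => f) →
        |h₁⁻¹ * (f (x₁ T) * Real.exp (∫ s in (0 : ℝ)..T, w s (x₁ s)) -
            f (x₀ T) * Real.exp (∫ s in (0 : ℝ)..T, w s (x₀ s))) -
          h₂⁻¹ * (f (x₂ T) * Real.exp (∫ s in (0 : ℝ)..T, w s (x₂ s)) -
            f (x₀ T) * Real.exp (∫ s in (0 : ℝ)..T, w s (x₀ s)))| ≤
          L * (|h₁| ^ α + |h₂| ^ α) := by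
  obtain ⟨L, hL, hLip⟩ := exists_trajectory_quotient_le hα hα1 hM hC hT hb hb₁
  have hg := gronwallBound_zero_one_nonneg hM hT
  set K := gronwallBound 0 M 1 T * M with hKdef
  have hK : 0 ≤ K := by positivity
  set D := C * K ^ α * K + M * L with hD
  refine ⟨(1 * K ^ α * K + 1 * L) * Real.exp (M * T) +
    1 * (Real.exp (M * T) * ((M * K * T) ^ 2 * Real.exp (M * K * T) + D * T)) +
    K * (Real.exp (M * T) * (M * K * T)), by positivity, ?_⟩
  intro x₀ x₁ x₂ h₁ h₂ hh₁ hh₂ hl₁ hl₂ hx₀ hx₁ hx₂ e₁ e₂ f hf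
  have B₁ {t} (ht : t ∈ Set.Icc 0 T) := trajectory_sub_le hb hb₁ hM hx₀ hx₁ e₁ ht
  have B₂ {t} (ht : t ∈ Set.Icc 0 T) := trajectory_sub_le hb hb₁ hM hx₀ hx₂ e₂ ht
  have Q := hLip x₀ x₁ x₂ h₁ h₂ hh₁ hh₂ hl₁ hl₂ hx₀ hx₁ hx₂ e₁ e₂
  rw [← hKdef] at B₁ B₂
  have hTT : T ∈ Set.Icc 0 T := ⟨hT, le_rfl⟩
  have mem {s : ℝ} (hs : s ∈ Set.uIoc 0 T) : s ∈ Set.Icc 0 T := by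
    rw [Set.uIoc_of_le hT] at hs
    exact Set.Ioc_subset_Icc_self hs
  have int {x v : ℝ → E} (hx : ∀ t, HasDerivAt x (v t) t) :
      IntervalIntegrable (fun s => w s (x s)) volume 0 T := by
    have hxc : Continuous x := continuous_iff_continuousAt.mpr fun t => (hx t).continuousAt
    exact (hwc.comp (continuous_id.prodMk hxc)).intervalIntegrable 0 T
  have wbound (x : ℝ → E) : |∫ s in (0 : ℝ)..T, w s (x s)| ≤ M * T := by
    have := intervalIntegral.norm_integral_le_of_norm_le_const (a := 0) (b := T)
      (f := fun s => w s (x s)) (C := M) (fun s _ => hw.norm_le s (x s))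
    simpa [abs_of_nonneg hT] using this
  have wdiff {x : ℝ → E} {h : ℝ} (hi : IntervalIntegrable (fun s => w s (x s)) volume 0 T)
      (B : ∀ {t}, t ∈ Set.Icc 0 T → ‖x t - x₀ t‖ ≤ K * |h|) :
      |(∫ s in (0 : ℝ)..T, w s (x s)) - ∫ s in (0 : ℝ)..T, w s (x₀ s)| ≤ M * K * T * |h| := by
    rw [← intervalIntegral.integral_sub hi (int hx₀)]
    have := intervalIntegral.norm_integral_le_of_norm_le_const (a := 0) (b := T)
      (f := fun s => w s (x s) - w s (x₀ s)) (C := M * (K * |h|)) (fun s hs => by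
        refine (hw.lipschitz _ _ _).trans ?_
        gcongr
        exact B (mem hs))
    rw [Real.norm_eq_abs, sub_zero, abs_of_nonneg hT] at this
    linarith
  have wquot : |h₁⁻¹ * ((∫ s in (0 : ℝ)..T, w s (x₁ s)) - ∫ s in (0 : ℝ)..T, w s (x₀ s)) -
      h₂⁻¹ * ((∫ s in (0 : ℝ)..T, w s (x₂ s)) - ∫ s in (0 : ℝ)..T, w s (x₀ s))| ≤
      D * T * (|h₁| ^ α + |h₂| ^ α) := by
    rw [← intervalIntegral.integral_sub (int hx₁) (int hx₀),
      ← intervalIntegral.integral_sub (int hx₂) (int hx₀),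
      ← intervalIntegral.integral_const_mul, ← intervalIntegral.integral_const_mul,
      ← intervalIntegral.integral_sub (((int hx₁).sub (int hx₀)).const_mul _)
        (((int hx₂).sub (int hx₀)).const_mul _)]
    have := intervalIntegral.norm_integral_le_of_norm_le_const (a := 0) (b := T)
      (f := fun s => h₁⁻¹ * (w s (x₁ s) - w s (x₀ s)) - h₂⁻¹ * (w s (x₂ s) - w s (x₀ s)))
      (C := D * (|h₁| ^ α + |h₂| ^ α)) (fun s hs => by
        have q := hw.quotient_sub_quotient_le hα.le hC hK hh₁ hh₂ (B₁ (mem hs)) (B₂ (mem hs)) s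
        have := mul_le_mul_of_nonneg_left (Q s (mem hs)) hM
        simp only [smul_eq_mul] at q
        rw [hD]
        linarith)
    rw [Real.norm_eq_abs, sub_zero, abs_of_nonneg hT] at this
    linarith
  have fdiff {x : ℝ → E} {h : ℝ} (B : ‖x T - x₀ T‖ ≤ K * |h|) :
      |f (x T) - f (x₀ T)| ≤ K * |h| := by
    have := hf.lipschitz 0 (x T) (x₀ T)
    rw [Real.norm_eq_abs] at this
    linarith
  have fquot : |h₁⁻¹ * (f (x₁ T) - f (x₀ T)) - h₂⁻¹ * (f (x₂ T) - f (x₀ T))| ≤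
      (1 * K ^ α * K + 1 * L) * (|h₁| ^ α + |h₂| ^ α) := by
    have q := hf.quotient_sub_quotient_le hα.le zero_le_one hK hh₁ hh₂ (B₁ hTT) (B₂ hTT) 0
    simp only [smul_eq_mul, Real.norm_eq_abs] at q
    linarith [Q T hTT]
  have ediff {x : ℝ → E} {h : ℝ}
      (B : |(∫ s in (0 : ℝ)..T, w s (x s)) - ∫ s in (0 : ℝ)..T, w s (x₀ s)| ≤ M * K * T * |h|) :
      |Real.exp (∫ s in (0 : ℝ)..T, w s (x s)) - Real.exp (∫ s in (0 : ℝ)..T, w s (x₀ s))| ≤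
        Real.exp (M * T) * (M * K * T) * |h| := by
    refine (abs_exp_sub_exp_le (wbound x) (wbound x₀)).trans ?_
    rw [mul_assoc (Real.exp _)]
    gcongr
  have D₁ := wdiff (int hx₁) B₁
  have D₂ := wdiff (int hx₂) B₂
  exact mul_quotient_sub_quotient_le hα1 hK (by positivity) hh₁ hh₂ hl₁ hl₂
    (hf.norm_le 0 _)
    (by rw [Real.abs_exp]; exact Real.exp_le_exp.mpr ((le_abs_self _).trans (wbound x₀)))
    (fdiff (B₁ hTT)) (fdiff (B₂ hTT)) (ediff D₁) (ediff D₂) fquot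
    (exp_quotient_sub_quotient_le hα1 (by positivity) hh₁ hh₂ hl₁ hl₂ (wbound x₀) D₁ D₂ wquot)

end Analysis

lemma HolderWith.norm_sub_le_mul_rpow {E G : Type*} [NormedAddCommGroup E]
    [NormedAddCommGroup G] {C : ℝ≥0} {α : ℝ} (hα : 0 ≤ α) {g : E → G}
    (hg : HolderWith C α.toNNReal g) (x y : E) : ‖g x - g y‖ ≤ C * ‖x - y‖ ^ α := by
  simpa [dist_eq_norm, Real.coe_toNNReal α hα] using hg.dist_le x y

lemma norm_sub_le_holderSemi_mul {d : ℕ} {α : ℝ} (hα : 0 < α) {C : ℝ≥0}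
    {g : Ed d → (Ed d →L[ℝ] ℝ)} (hg : HolderWith C α.toNNReal g) (x y : Ed d) :
    ‖g x - g y‖ ≤ holderSemi α g * ‖x - y‖ ^ α := by
  have hle (x y : Ed d) : ‖g x - g y‖ / dist x y ^ α ≤ C := by
    refine div_le_of_le_mul₀ (by positivity) C.2 ?_
    rw [dist_eq_norm]
    exact hg.norm_sub_le_mul_rpow hα.le x y
  have inner (x : Ed d) : BddAbove (Set.range fun y => ‖g x - g y‖ / dist x y ^ α) :=
    ⟨C, by rintro _ ⟨y, rfl⟩; exact hle x y⟩
  have outer : BddAbove (Set.range fun x => ⨆ y, ‖g x - g y‖ / dist x y ^ α) :=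
    ⟨C, by rintro _ ⟨x, rfl⟩; exact ciSup_le (hle x)⟩
  have key : ‖g x - g y‖ / dist x y ^ α ≤ holderSemi α g :=
    (le_ciSup (inner x) y).trans (le_ciSup outer x)
  rcases eq_or_ne x y with rfl | hxy
  · simp [hα.ne']
  · rwa [div_le_iff₀ (Real.rpow_pos_of_pos (dist_pos.mpr hxy) α), dist_eq_norm] at key

lemma MemC1a.uniformC1a {d : ℕ} {α : ℝ} (hα : 0 < α) {f : Ed d → ℝ} (hf : MemC1a α f)
    (h1 : c1aNorm α f ≤ 1) : UniformC1a α 1 1 (fun _ => f) := by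
  obtain ⟨hd, hb, hb', C, hC⟩ := hf
  have n₁ : 0 ≤ ⨆ x, |f x| := Real.iSup_nonneg fun _ => abs_nonneg _
  have n₂ : 0 ≤ ⨆ x, ‖fderiv ℝ f x‖ := Real.iSup_nonneg fun _ => norm_nonneg _
  have n₃ : 0 ≤ holderSemi α (fderiv ℝ f) :=
    Real.iSup_nonneg fun _ => Real.iSup_nonneg fun _ => by positivity
  unfold c1aNorm at h1
  refine ⟨fun _ => hd.differentiable one_ne_zero, fun _ x => ?_, fun _ x => ?_, fun _ x y => ?_⟩
  · exact (le_ciSup hb x).trans (by linarith)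
  · exact (le_ciSup hb' x).trans (by linarith)
  · refine (norm_sub_le_holderSemi_mul hα hC x y).trans ?_
    gcongr
    linarith

lemma VecTimeC1a.exists_uniformC1a {d : ℕ} {α : ℝ} (hα : 0 ≤ α) {b : ℝ → Ed d → Ed d}
    (hb : VecTimeC1a α b) : ∃ M C : ℝ, UniformC1a α M C b := by
  obtain ⟨-, hd, ⟨M, hM⟩, C, hC⟩ := hb
  exact ⟨M, C, fun t => (hd t).differentiable one_ne_zero,
    fun t x => by linarith [hM t x, norm_nonneg (fderiv ℝ (b t) x)],
    fun t x => by linarith [hM t x, norm_nonneg (b t x)],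
    fun t => (hC t).norm_sub_le_mul_rpow hα⟩

lemma ScalTimeC1a.exists_uniformC1a {d : ℕ} {α : ℝ} (hα : 0 ≤ α) {w : ℝ → Ed d → ℝ}
    (hw : ScalTimeC1a α w) : ∃ M C : ℝ, UniformC1a α M C w := by
  obtain ⟨-, hd, ⟨M, hM⟩, C, hC⟩ := hw
  exact ⟨M, C, fun t => (hd t).differentiable one_ne_zero,
    fun t x => by rw [Real.norm_eq_abs]; linarith [hM t x, norm_nonneg (fderiv ℝ (w t) x)],
    fun t x => by linarith [hM t x, abs_nonneg (w t x)],
    fun t => (hC t).norm_sub_le_mul_rpow hα⟩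

lemma continuous_flow {E : Type*} [NormedAddCommGroup E] [NormedSpace ℝ E] {α M C h : ℝ}
    {b b₁ : ℝ → E → E} (hb : UniformC1a α M C b) (hb₁ : UniformC1a α M C b₁)
    {Φ : ℝ → E → E} (hΦ0 : ∀ y, Φ 0 y = y)
    (hΦ : ∀ y t, HasDerivAt (fun s => Φ s y) (b t (Φ t y) + h • b₁ t (Φ t y)) t)
    {t : ℝ} (ht : 0 ≤ t) : Continuous (Φ t) := by
  have lip (y z : E) : ‖Φ t y - Φ t z‖ ≤ Real.exp ((M + |h| * M) * t) * ‖y - z‖ := by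
    have := norm_le_gronwallBound_of_norm_deriv_right_le
      (f := fun s => Φ s y - Φ s z) (δ := ‖y - z‖) (K := M + |h| * M) (ε := 0) (a := 0) (b := t)
      (fun s _ => ((hΦ y s).sub (hΦ z s)).continuousAt.continuousWithinAt)
      (fun s _ => ((hΦ y s).sub (hΦ z s)).hasDerivWithinAt) (by simp [hΦ0])
      (fun s _ => by
        have e : b s (Φ s y) + h • b₁ s (Φ s y) - (b s (Φ s z) + h • b₁ s (Φ s z)) =
          (b s (Φ s y) - b s (Φ s z)) + h • (b₁ s (Φ s y) - b₁ s (Φ s z)) := by module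
        rw [e]
        refine (norm_add_le _ _).trans ?_
        rw [norm_smul, Real.norm_eq_abs]
        have l₁ := hb.lipschitz s (Φ s y) (Φ s z)
        have l₂ := mul_le_mul_of_nonneg_left (hb₁.lipschitz s (Φ s y) (Φ s z)) (abs_nonneg h)
        linarith) t ⟨ht, le_rfl⟩
    rw [gronwallBound_ε0, sub_zero] at this
    linarith
  refine LipschitzWith.continuous (K := (Real.exp ((M + |h| * M) * t)).toNNReal) ?_
  refine LipschitzWith.of_dist_le_mul fun y z => ?_
  rw [dist_eq_norm, dist_eq_norm, Real.coe_toNNReal _ (Real.exp_pos _).le]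
  exact lip y z

lemma continuous_integral_along_flow {E : Type*} [NormedAddCommGroup E] {M T : ℝ} (hT : 0 ≤ T)
    {w : ℝ → E → ℝ} (hwc : Continuous (Function.uncurry w)) (hw : ∀ t x, ‖w t x‖ ≤ M)
    {Φ : ℝ → E → E} (hΦt : ∀ y, Continuous fun s => Φ s y) (hΦ : ∀ s, 0 ≤ s → Continuous (Φ s)) :
    Continuous fun y => ∫ s in (0 : ℝ)..T, w s (Φ s y) := by
  refine intervalIntegral.continuous_of_dominated_interval (bound := fun _ => M)
    (fun y => (hwc.comp (continuous_id.prodMk (hΦt y))).aestronglyMeasurable)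
    (fun y => ae_of_all _ fun s _ => hw _ _) intervalIntegrable_const
    (ae_of_all _ fun s hs => ?_)
  rw [Set.uIoc_of_le hT] at hs
  exact hwc.comp (continuous_const.prodMk (hΦ s hs.1.le))

lemma integral_map_withDensity_ofReal {Ω Ω' : Type*} [MeasurableSpace Ω] [MeasurableSpace Ω']
    {μ : Measure Ω} {T : Ω → Ω'} {ρ : Ω → ℝ} (hT : Measurable T) (hρ : Measurable ρ)
    (hρ0 : ∀ y, 0 ≤ ρ y) {f : Ω' → ℝ} (hf : StronglyMeasurable f) :
    ∫ x, f x ∂(Measure.map T (μ.withDensity fun y => ENNReal.ofReal (ρ y))) =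
      ∫ y, f (T y) * ρ y ∂μ := by
  rw [integral_map hT.aemeasurable hf.aestronglyMeasurable,
    integral_withDensity_eq_integral_toReal_smul hρ.ennreal_ofReal (by simp)]
  refine integral_congr_ae (ae_of_all _ fun y => ?_)
  simp [ENNReal.toReal_ofReal (hρ0 y), mul_comm]

lemma sPair_toSignedMeasure_sub {d : ℕ} (μ ν : Measure (Ed d)) [IsFiniteMeasure μ]
    [IsFiniteMeasure ν] {f : Ed d → ℝ}
    (hf : ∀ m : Measure (Ed d), IsFiniteMeasure m → Integrable f m) :
    sPair (μ.toSignedMeasure - ν.toSignedMeasure) f = (∫ x, f x ∂μ) - ∫ x, f x ∂ν := by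
  set s := μ.toSignedMeasure - ν.toSignedMeasure with hs
  set j := s.toJordanDecomposition
  have hj : j.posPart.toSignedMeasure - j.negPart.toSignedMeasure =
      μ.toSignedMeasure - ν.toSignedMeasure :=
    (SignedMeasure.toSignedMeasure_toJordanDecomposition s).trans hs
  have hadd : j.posPart + ν = μ + j.negPart := by
    rw [← Measure.toSignedMeasure_eq_toSignedMeasure_iff, Measure.toSignedMeasure_add,
      Measure.toSignedMeasure_add]
    rw [sub_eq_sub_iff_add_eq_add] at hj
    exact hj
  have h := congrArg (fun m => ∫ x, f x ∂m) hadd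
  rw [integral_add_measure (hf _ inferInstance) (hf _ inferInstance),
    integral_add_measure (hf _ inferInstance) (hf _ inferInstance)] at h
  unfold sPair
  linarith

lemma exists_signedMeasure_sPair_eq {d : ℕ} (μ ν : Measure (Ed d)) [IsFiniteMeasure μ]
    [IsFiniteMeasure ν] (c : ℝ) : ∃ s : SignedMeasure (Ed d), ∀ f : Ed d → ℝ,
      (∀ m : Measure (Ed d), IsFiniteMeasure m → Integrable f m) →
        sPair s f = c * ((∫ x, f x ∂μ) - ∫ x, f x ∂ν) := by
  wlog hc : 0 ≤ c generalizing μ ν c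
  · obtain ⟨s, hs⟩ := this ν μ (-c) (by linarith)
    exact ⟨s, fun f hf => by rw [hs f hf]; ring⟩
  refine ⟨(c.toNNReal • μ).toSignedMeasure - (c.toNNReal • ν).toSignedMeasure, fun f hf => ?_⟩
  rw [sPair_toSignedMeasure_sub _ _ hf, integral_smul_nnreal_measure,
    integral_smul_nnreal_measure, NNReal.smul_def, NNReal.smul_def, Real.coe_toNNReal c hc,
    smul_eq_mul, smul_eq_mul, mul_sub]

lemma dualNorm_le {d : ℕ} {α ε : ℝ} (hε : 0 ≤ ε) {L : (Ed d → ℝ) → ℝ}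
    (h : ∀ f, MemC1a α f → c1aNorm α f ≤ 1 → |L f| ≤ ε) : dualNorm α L ≤ ε := by
  refine Real.sSup_le ?_ hε
  rintro _ ⟨f, hf, hf1, rfl⟩
  exact h f hf hf1

/-- The difference quotients of `h ↦ μ_t^h`, tested against the unit ball of `C^{1+α}`, satisfy
a uniform Cauchy estimate of order `|h₁|^α + |h₂|^α`. -/
lemma exists_muSol_quotient_le {d : ℕ} {α : ℝ} (hα : 0 < α) (hα1 : α ≤ 1)
    {b b₁ : ℝ → Ed d → Ed d} {w : ℝ → Ed d → ℝ}
    (hb : VecTimeC1a α b) (hb₁ : VecTimeC1a α b₁) (hw : ScalTimeC1a α w)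
    (μ₀ : Measure (Ed d)) [IsProbabilityMeasure μ₀] {X : ℝ → Ed d → ℝ → Ed d}
    (hX0 : ∀ y h, X 0 y h = y)
    (hXode : ∀ (y : Ed d), ∀ h ∈ Set.Icc (-(1 : ℝ) / 2) (1 / 2), ∀ t : ℝ,
      HasDerivAt (fun τ => X τ y h) (b t (X t y h) + h • b₁ t (X t y h)) t)
    {t : ℝ} (ht : 0 ≤ t) :
    (∀ h ∈ Set.Icc (-(1 : ℝ) / 2) (1 / 2), IsFiniteMeasure (muSol X w μ₀ t h)) ∧
    ∃ L : ℝ, 0 ≤ L ∧ ∀ f, MemC1a α f → c1aNorm α f ≤ 1 →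
      ∀ h₁ ∈ Set.Icc (-(1 : ℝ) / 2) (1 / 2), ∀ h₂ ∈ Set.Icc (-(1 : ℝ) / 2) (1 / 2),
      h₁ ≠ 0 → h₂ ≠ 0 →
        |((∫ x, f x ∂(muSol X w μ₀ t h₁)) - ∫ x, f x ∂(muSol X w μ₀ t 0)) / h₁ -
          ((∫ x, f x ∂(muSol X w μ₀ t h₂)) - ∫ x, f x ∂(muSol X w μ₀ t 0)) / h₂| ≤
          L * (|h₁| ^ α + |h₂| ^ α) := by
  obtain ⟨M₁, C₁, hb'⟩ := hb.exists_uniformC1a hα.le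
  obtain ⟨M₂, C₂, hb₁'⟩ := hb₁.exists_uniformC1a hα.le
  obtain ⟨M₃, C₃, hw'⟩ := hw.exists_uniformC1a hα.le
  obtain ⟨M, hM, m₁, m₂, m₃⟩ : ∃ M : ℝ, 0 ≤ M ∧ M₁ ≤ M ∧ M₂ ≤ M ∧ M₃ ≤ M :=
    ⟨max 0 (max M₁ (max M₂ M₃)), by simp⟩
  obtain ⟨C, hC, c₁, c₂, c₃⟩ : ∃ C : ℝ, 0 ≤ C ∧ C₁ ≤ C ∧ C₂ ≤ C ∧ C₃ ≤ C :=
    ⟨max 0 (max C₁ (max C₂ C₃)), by simp⟩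
  replace hb' := hb'.mono m₁ c₁
  replace hb₁' := hb₁'.mono m₂ c₂
  replace hw' := hw'.mono m₃ c₃
  have contX {h : ℝ} (hh : h ∈ Set.Icc (-(1 : ℝ) / 2) (1 / 2)) {s : ℝ} (hs : 0 ≤ s) :
      Continuous fun y => X s y h :=
    continuous_flow (Φ := fun s y => X s y h) hb' hb₁' (fun y => hX0 y h)
      (fun y => hXode y h hh) hs
  have contE {h : ℝ} (hh : h ∈ Set.Icc (-(1 : ℝ) / 2) (1 / 2)) :
      Continuous fun y => Real.exp (∫ s in (0 : ℝ)..t, w s (X s y h)) :=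
    Real.continuous_exp.comp <| continuous_integral_along_flow (Φ := fun s y => X s y h) ht hw.1
      hw'.norm_le (fun y => continuous_iff_continuousAt.mpr fun s => (hXode y h hh s).continuousAt)
      (fun s hs => contX hh hs)
  have boundE (h : ℝ) (y : Ed d) : Real.exp (∫ s in (0 : ℝ)..t, w s (X s y h)) ≤
      Real.exp (M * t) := by
    have := intervalIntegral.norm_integral_le_of_norm_le_const (a := 0) (b := t)
      (f := fun s => w s (X s y h)) (C := M) (fun s _ => hw'.norm_le s _)
    rw [sub_zero, abs_of_nonneg ht] at this
    exact Real.exp_le_exp.mpr ((le_abs_self _).trans this)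
  have intE {h : ℝ} (hh : h ∈ Set.Icc (-(1 : ℝ) / 2) (1 / 2)) :
      Integrable (fun y => Real.exp (∫ s in (0 : ℝ)..t, w s (X s y h))) μ₀ :=
    Integrable.of_bound (contE hh).aestronglyMeasurable (Real.exp (M * t))
      (ae_of_all _ fun y => by rw [Real.norm_eq_abs, Real.abs_exp]; exact boundE h y)
  refine ⟨fun h hh => ?_, ?_⟩
  · have := isFiniteMeasure_withDensity_ofReal (intE hh).2
    unfold muSol
    infer_instance
  obtain ⟨L, hL, H⟩ := exists_weighted_quotient_le hα hα1 hM hC ht hb' hb₁' hw' hw.1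
  refine ⟨L, hL, fun f hf hf1 h₁ hh₁ h₂ hh₂ hn₁ hn₂ => ?_⟩
  have hfu := hf.uniformC1a hα hf1
  have form {h : ℝ} (hh : h ∈ Set.Icc (-(1 : ℝ) / 2) (1 / 2)) :
      ∫ x, f x ∂(muSol X w μ₀ t h) =
        ∫ y, f (X t y h) * Real.exp (∫ s in (0 : ℝ)..t, w s (X s y h)) ∂μ₀ :=
    integral_map_withDensity_ofReal (contX hh ht).measurable (contE hh).measurable
      (fun y => (Real.exp_pos _).le) hf.1.continuous.stronglyMeasurable
  have int {h : ℝ} (hh : h ∈ Set.Icc (-(1 : ℝ) / 2) (1 / 2)) :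
      Integrable (fun y => f (X t y h) * Real.exp (∫ s in (0 : ℝ)..t, w s (X s y h))) μ₀ :=
    (intE hh).bdd_mul (hf.1.continuous.comp (contX hh ht)).aestronglyMeasurable
      (ae_of_all _ fun y => hfu.norm_le 0 (X t y h))
  have h0 : (0 : ℝ) ∈ Set.Icc (-(1 : ℝ) / 2) (1 / 2) := by constructor <;> norm_num
  have dint {h : ℝ} (hh : h ∈ Set.Icc (-(1 : ℝ) / 2) (1 / 2)) :
      Integrable (fun y => h⁻¹ *
        (f (X t y h) * Real.exp (∫ s in (0 : ℝ)..t, w s (X s y h)) -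
          f (X t y 0) * Real.exp (∫ s in (0 : ℝ)..t, w s (X s y 0)))) μ₀ :=
    ((int hh).sub (int h0)).const_mul _
  have habs {h : ℝ} (hh : h ∈ Set.Icc (-(1 : ℝ) / 2) (1 / 2)) : |h| ≤ 1 :=
    abs_le.mpr ⟨by linarith [hh.1], by linarith [hh.2]⟩
  rw [form hh₁, form hh₂, form h0, div_eq_inv_mul, div_eq_inv_mul,
    ← integral_sub (int hh₁) (int h0), ← integral_sub (int hh₂) (int h0),
    ← integral_const_mul, ← integral_const_mul,
    ← integral_sub (dint hh₁) (dint hh₂)]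
  have := norm_integral_le_of_norm_le_const (μ := μ₀)
    (f := fun y => h₁⁻¹ * (f (X t y h₁) * Real.exp (∫ s in (0 : ℝ)..t, w s (X s y h₁)) -
        f (X t y 0) * Real.exp (∫ s in (0 : ℝ)..t, w s (X s y 0))) -
      h₂⁻¹ * (f (X t y h₂) * Real.exp (∫ s in (0 : ℝ)..t, w s (X s y h₂)) -
        f (X t y 0) * Real.exp (∫ s in (0 : ℝ)..t, w s (X s y 0))))
    (C := L * (|h₁| ^ α + |h₂| ^ α))
    (ae_of_all _ fun y => H (fun s => X s y 0) (fun s => X s y h₁) (fun s => X s y h₂) h₁ h₂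
      hn₁ hn₂ (habs hh₁) (habs hh₂) (hXode y 0 h0) (hXode y h₁ hh₁) (hXode y h₂ hh₂)
      (by rw [hX0, hX0]) (by rw [hX0, hX0]) f hfu)
  simpa using this

lemma exists_pos_forall_mul_rpow_add_rpow_le {α L ε : ℝ} (hα : 0 < α) (hL : 0 ≤ L) (hε : 0 < ε) :
    ∃ δ > (0 : ℝ), ∀ h₁ h₂ : ℝ, |h₁| ≤ δ → |h₂| ≤ δ → L * (|h₁| ^ α + |h₂| ^ α) ≤ ε := by
  refine ⟨(ε / (2 * L + 1)) ^ α⁻¹, by positivity, fun h₁ h₂ hh₁ hh₂ => ?_⟩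
  have pow {h : ℝ} (hh : |h| ≤ (ε / (2 * L + 1)) ^ α⁻¹) : |h| ^ α ≤ ε / (2 * L + 1) :=
    (Real.le_rpow_inv_iff_of_pos (abs_nonneg h) (by positivity) hα).mp hh
  calc L * (|h₁| ^ α + |h₂| ^ α) ≤ L * (ε / (2 * L + 1) + ε / (2 * L + 1)) := by
        gcongr
        exacts [pow hh₁, pow hh₂]
    _ = ε * (2 * L / (2 * L + 1)) := by ring
    _ ≤ ε := mul_le_of_le_one_right hε.le ((div_le_one (by positivity)).mpr (by linarith))

/-- Differentiability at h = 0 of h ↦ μ_t^h in Z = closure of M(ℝ^d) in (C^{1+α})*: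
the difference quotients (μ_t^h − μ_t^0)/h are Cauchy in the dual norm as h → 0 and
converge to a limit D (the derivative), independent of the sequence, with D ∈ Z. -/
theorem solution_differentiable_in_parameter (d : ℕ) (α : ℝ) (hα : 0 < α) (hα1 : α ≤ 1)
    (b b₁ : ℝ → Ed d → Ed d) (w : ℝ → Ed d → ℝ)
    (hb : VecTimeC1a α b) (hb₁ : VecTimeC1a α b₁) (hw : ScalTimeC1a α w)
    (μ₀ : Measure (Ed d)) [IsProbabilityMeasure μ₀]
    (X : ℝ → Ed d → ℝ → Ed d)
    (hX0 : ∀ y h, X 0 y h = y)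
    (hXode : ∀ (y : Ed d), ∀ h ∈ Set.Icc (-(1:ℝ)/2) (1/2), ∀ t : ℝ,
      HasDerivAt (fun τ => X τ y h) (b t (X t y h) + h • b₁ t (X t y h)) t) :
    ∀ t ≥ (0:ℝ),
      -- the difference quotients are Cauchy in the dual norm as h → 0
      (∀ ε > (0:ℝ), ∃ δ > (0:ℝ),
        ∀ h₁ ∈ Set.Icc (-(1:ℝ)/2) (1/2), ∀ h₂ ∈ Set.Icc (-(1:ℝ)/2) (1/2),
        h₁ ≠ 0 → h₂ ≠ 0 → |h₁| ≤ δ → |h₂| ≤ δ →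
        dualNorm α (fun f =>
            ((∫ x, f x ∂(muSol X w μ₀ t h₁)) - ∫ x, f x ∂(muSol X w μ₀ t 0)) / h₁ -
            ((∫ x, f x ∂(muSol X w μ₀ t h₂)) - ∫ x, f x ∂(muSol X w μ₀ t 0)) / h₂) ≤ ε) ∧
      -- hence they converge to a derivative D which belongs to Z
      (∃ D : W d, InZM α D ∧
        ∀ ε > (0:ℝ), ∃ δ > (0:ℝ), ∀ h ∈ Set.Icc (-(1:ℝ)/2) (1/2), h ≠ 0 → |h| ≤ δ →
          dualNorm α (fun f =>
              ((∫ x, f x ∂(muSol X w μ₀ t h)) - ∫ x, f x ∂(muSol X w μ₀ t 0)) / h -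
                D f) ≤ ε) := by
  intro t ht
  obtain ⟨hfin, L, hL, H⟩ := exists_muSol_quotient_le hα hα1 hb hb₁ hw μ₀ hX0 hXode ht
  have small {ε : ℝ} (hε : 0 < ε) := exists_pos_forall_mul_rpow_add_rpow_le hα hL hε
  have h0 : (0 : ℝ) ∈ Set.Icc (-(1 : ℝ) / 2) (1 / 2) := by constructor <;> norm_num
  refine ⟨fun ε hε => ?_, ?_⟩
  · obtain ⟨δ, hδ, hs⟩ := small hε
    exact ⟨δ, hδ, fun h₁ hh₁ h₂ hh₂ hn₁ hn₂ hl₁ hl₂ => dualNorm_le hε.le fun f hf hf1 =>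
      (H f hf hf1 h₁ hh₁ h₂ hh₂ hn₁ hn₂).trans (hs h₁ h₂ hl₁ hl₂)⟩
  set q : (Ed d → ℝ) → ℝ → ℝ := fun f h =>
    ((∫ x, f x ∂(muSol X w μ₀ t h)) - ∫ x, f x ∂(muSol X w μ₀ t 0)) / h with hq
  have near {δ : ℝ} (hδ : 0 < δ) :
      ∀ᶠ h in 𝓝[≠] (0 : ℝ), h ∈ Set.Icc (-(1 : ℝ) / 2) (1 / 2) ∧ h ≠ 0 ∧ |h| ≤ δ := by
    have h₁ : ∀ᶠ h in 𝓝[≠] (0 : ℝ), h ∈ Set.Icc (-(1 : ℝ) / 2) (1 / 2) :=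
      eventually_nhdsWithin_of_eventually_nhds (Icc_mem_nhds (by norm_num) (by norm_num))
    have h₂ : ∀ᶠ h in 𝓝[≠] (0 : ℝ), |h| ≤ δ := by
      refine eventually_nhdsWithin_of_eventually_nhds ?_
      filter_upwards [Metric.closedBall_mem_nhds (0 : ℝ) hδ] with h hh
      simpa using hh
    filter_upwards [h₁, h₂, self_mem_nhdsWithin] with h a c e using ⟨a, e, c⟩
  have lim (f : Ed d → ℝ) (hf : MemC1a α f) (hf1 : c1aNorm α f ≤ 1) :
      Tendsto (q f) (𝓝[≠] 0) (𝓝 (limUnder (𝓝[≠] 0) (q f))) := by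
    refine tendsto_nhds_limUnder (cauchy_map_iff_exists_tendsto.mp ?_)
    refine Metric.cauchy_iff.mpr ⟨inferInstance, fun ε hε => ?_⟩
    obtain ⟨δ, hδ, hs⟩ := small (half_pos hε)
    refine ⟨_, image_mem_map (near hδ), ?_⟩
    rintro _ ⟨h₁, ⟨hh₁, hn₁, hl₁⟩, rfl⟩ _ ⟨h₂, ⟨hh₂, hn₂, hl₂⟩, rfl⟩
    exact ((H f hf hf1 h₁ hh₁ h₂ hh₂ hn₁ hn₂).trans (hs h₁ h₂ hl₁ hl₂)).trans_lt (half_lt_self hε)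
  have conv {ε : ℝ} (hε : 0 < ε) : ∃ δ > (0 : ℝ), ∀ h ∈ Set.Icc (-(1 : ℝ) / 2) (1 / 2), h ≠ 0 →
      |h| ≤ δ → ∀ f, MemC1a α f → c1aNorm α f ≤ 1 →
        |q f h - limUnder (𝓝[≠] 0) (q f)| ≤ ε := by
    obtain ⟨δ, hδ, hs⟩ := small hε
    refine ⟨δ, hδ, fun h hh hn hl f hf hf1 => ?_⟩
    refine le_of_tendsto ((tendsto_const_nhds (x := q f h)).sub (lim f hf hf1)).abs ?_
    filter_upwards [near hδ] with k hk
    exact (H f hf hf1 h hh k hk.1 hn hk.2.1).trans (hs h k hl hk.2.2)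
  refine ⟨fun f => limUnder (𝓝[≠] 0) (q f), fun ε hε => ?_, fun ε hε => ?_⟩
  · obtain ⟨δ, hδ, hc⟩ := conv hε
    obtain ⟨h, hh, hn, hl⟩ := (near hδ).exists
    have := hfin h hh
    have := hfin 0 h0
    obtain ⟨s, hs⟩ := exists_signedMeasure_sPair_eq (muSol X w μ₀ t h) (muSol X w μ₀ t 0) h⁻¹
    refine ⟨s, dualNorm_le hε.le fun f hf hf1 => ?_⟩
    have hbound := (hf.uniformC1a hα hf1).norm_le 0
    rw [hs f fun m _ => Integrable.of_bound hf.1.continuous.aestronglyMeasurable 1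
      (ae_of_all _ hbound), ← div_eq_inv_mul, abs_sub_comm]
    exact hc h hh hn hl f hf hf1
  · obtain ⟨δ, hδ, hc⟩ := conv hε
    exact ⟨δ, hδ, fun h hh hn hl => dualNorm_le hε.le fun f hf hf1 => hc h hh hn hl f hf hf1⟩
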